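/- arXiv:1008.3077 — 3 statements merged into one kernel-verified Lean document; each statement's English description precedes it below -/
import Mathlib

section
/- For every real sequence {c_k}_{k≥1}, the set of parameters t ∈ (0,∞) for which every solution {q_k}_{k≥0} of the difference equation q_{k+1} − (2 + t c_k) q_k + q_{k−1} = 0 (k ≥ 1) is bounded, has finite Lebesgue measure. -/
open MeasureTheory Filter Polynomial Set

/-- The solution with initial values `a, b` of `q (k + 2) = f (k + 1) * q (k + 1) - q k`. -/
def recSol {A : Type*} [CommRing A] (f : ℕ → A) (a b : A) : ℕ → A
  | 0 => a
  | 1 => b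
  | n + 2 => f (n + 1) * recSol f a b (n + 1) - recSol f a b n

theorem map_recSol {A B : Type*} [CommRing A] [CommRing B] (φ : A →+* B) (f : ℕ → A) (a b : A) :
    ∀ n, φ (recSol f a b n) = recSol (fun k => φ (f k)) (φ a) (φ b) n
  | 0 => rfl
  | 1 => rfl
  | n + 2 => by
    simp only [recSol, map_sub, map_mul, map_recSol φ f a b n, map_recSol φ f a b (n + 1)]

theorem recSol_wronskian {A : Type*} [CommRing A] (f : ℕ → A) (n : ℕ) :
    recSol f 0 1 (n + 1) * recSol f 1 0 n - recSol f 0 1 n * recSol f 1 0 (n + 1) = 1 := by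
  induction n with
  | zero => simp [recSol]
  | succ n ih =>
    simp only [recSol]
    linear_combination ih

theorem natDegree_recSol_le (c : ℕ → ℂ) (n : ℕ) :
    (recSol (fun k => 2 + C (c k) * X) 0 1 (n + 1)).natDegree ≤ n := by
  induction n using Nat.twoStepInduction with
  | zero => simp [recSol]
  | one =>
    simp only [recSol]
    compute_degree
  | more n h₁ h₂ =>
    rw [recSol]
    refine (natDegree_sub_le _ _).trans (max_le ?_ (h₁.trans (by omega)))
    refine natDegree_mul_le.trans ?_
    have : (2 + C (c (n + 1 + 1)) * X : ℂ[X]).natDegree ≤ 1 := by compute_degree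
    omega

/-- If the coefficients are small on a long window, a bounded solution has small increments. -/
theorem increment_le_of_small {u g : ℕ → ℝ} {M : ℝ} {k L : ℕ} (hL : 0 < L)
    (hu : ∀ n, u (n + 2) = (2 + g (n + 1)) * u (n + 1) - u n) (hM : ∀ n, |u n| ≤ M)
    (hg : ∀ i, k < i → i ≤ k + L → |g i| ≤ 1 / (L : ℝ) ^ 2) :
    |u (k + 1) - u k| ≤ 3 * M / L := by
  have hL' : (0 : ℝ) < L := by exact_mod_cast hL
  have hM0 : 0 ≤ M := (abs_nonneg _).trans (hM 0)
  have hd : ∀ j : ℕ, j ≤ L →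
      |u (k + j + 1) - u (k + j) - (u (k + 1) - u k)| ≤ j * (M / (L : ℝ) ^ 2) := by
    intro j
    induction j with
    | zero => simp
    | succ j ih =>
      intro hj
      have h1 := ih (by omega)
      have h2 := hg (k + j + 1) (by omega) (by omega)
      have h3 : |g (k + j + 1) * u (k + j + 1)| ≤ M / (L : ℝ) ^ 2 := by
        rw [abs_mul]
        calc _ ≤ 1 / (L : ℝ) ^ 2 * M := by gcongr; exact hM _
          _ = _ := by ring
      have h4 := hu (k + j)
      have h5 : u (k + (j + 1) + 1) - u (k + (j + 1)) - (u (k + 1) - u k)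
          = (u (k + j + 1) - u (k + j) - (u (k + 1) - u k)) + g (k + j + 1) * u (k + j + 1) := by
        rw [show k + (j + 1) + 1 = k + j + 2 by ring, show k + (j + 1) = k + j + 1 by ring, h4]
        ring
      rw [h5]
      push_cast
      have := abs_add_le (u (k + j + 1) - u (k + j) - (u (k + 1) - u k))
        (g (k + j + 1) * u (k + j + 1))
      linarith
  have he : ∀ j : ℕ, j ≤ L → |u (k + j) - u k - j * (u (k + 1) - u k)| ≤ j * (M / L) := by
    intro j
    induction j with
    | zero => simp
    | succ j ih =>
      intro hj
      have h1 := ih (by omega)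
      have h2 := hd j (by omega)
      have h3 : (j : ℝ) * (M / (L : ℝ) ^ 2) ≤ M / L := by
        have : (j : ℝ) ≤ L := by exact_mod_cast (by omega : j ≤ L)
        calc (j : ℝ) * (M / (L : ℝ) ^ 2) ≤ L * (M / (L : ℝ) ^ 2) := by gcongr
          _ = M / L := by field_simp
      have h5 : u (k + (j + 1)) - u k - ((j + 1 : ℕ) : ℝ) * (u (k + 1) - u k)
          = (u (k + j) - u k - j * (u (k + 1) - u k))
            + (u (k + j + 1) - u (k + j) - (u (k + 1) - u k)) := by
        push_cast
        rw [← add_assoc]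
        ring
      rw [h5]
      push_cast
      have := abs_add_le (u (k + j) - u k - j * (u (k + 1) - u k))
        (u (k + j + 1) - u (k + j) - (u (k + 1) - u k))
      linarith
  have h := he L le_rfl
  rw [mul_div_cancel₀ _ hL'.ne'] at h
  have hk := abs_le.1 (hM k)
  have hkL := abs_le.1 (hM (k + L))
  have h := abs_le.1 h
  rw [abs_le, ← neg_div, div_le_iff₀ hL', le_div_iff₀ hL']
  constructor <;> linarith

theorem exists_window {c : ℕ → ℝ} {t M : ℝ} (ht : 0 < t)
    (hu : ∀ n, |recSol (fun k => 2 + t * c k) 0 1 n| ≤ M)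
    (hv : ∀ n, |recSol (fun k => 2 + t * c k) 1 0 n| ≤ M) :
    ∃ δ > 0, ∃ L : ℕ, ∀ k, ∃ i, k < i ∧ i ≤ k + L ∧ δ ≤ |c i| := by
  obtain ⟨L, hL⟩ := exists_nat_gt (6 * M ^ 2)
  have hM0 : 0 ≤ M := (abs_nonneg _).trans (hu 0)
  have hL' : (0 : ℝ) < L := lt_of_le_of_lt (by positivity) hL
  have hL0 : 0 < L := by exact_mod_cast hL'
  refine ⟨1 / (L : ℝ) ^ 2 / t, by positivity, L, fun k => ?_⟩
  by_contra! hc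
  have hg : ∀ i, k < i → i ≤ k + L → |t * c i| ≤ 1 / (L : ℝ) ^ 2 := by
    intro i h1 h2
    have := hc i h1 h2
    rw [lt_div_iff₀ ht] at this
    rw [abs_mul, abs_of_pos ht]
    linarith
  have h1 := increment_le_of_small hL0 (g := fun i => t * c i) (fun n => rfl) hu hg
  have h2 := increment_le_of_small hL0 (g := fun i => t * c i) (fun n => rfl) hv hg
  have hW := recSol_wronskian (fun k => 2 + t * c k) k
  have huk := hu k
  have hvk := hv k
  generalize recSol (fun k => 2 + t * c k) 0 1 k = u at *
  generalize recSol (fun k => 2 + t * c k) 1 0 k = v at *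
  generalize recSol (fun k => 2 + t * c k) 0 1 (k + 1) = u' at *
  generalize recSol (fun k => 2 + t * c k) 1 0 (k + 1) = v' at *
  have h3 : (1 : ℝ) ≤ |u' - u| * |v| + |u| * |v' - v| := by
    rw [← abs_mul, ← abs_mul]
    have e1 := le_abs_self ((u' - u) * v)
    have e2 := neg_abs_le (u * (v' - v))
    linarith
  have h4 : |u' - u| * |v| ≤ 3 * M / L * M := by gcongr
  have h5 : |u| * |v' - v| ≤ M * (3 * M / L) := by gcongr
  have h6 : 3 * M / L * M + M * (3 * M / L) = 6 * M ^ 2 / L := by ring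
  have h7 : 6 * M ^ 2 / L < 1 := by rwa [div_lt_one hL']
  linarith

theorem norm_recSol_growth {c : ℕ → ℝ} {δ : ℝ} {L : ℕ}
    (hc : ∀ k, ∃ i, k < i ∧ i ≤ k + L ∧ δ ≤ |c i|) {R : ℝ} (hR : 0 < R) (hRδ : 2 ≤ R * δ) (m : ℕ) :
    (δ / 2 * R) ^ m ≤
      ‖recSol (fun k => 2 + (c k : ℂ) * (R * Complex.I)) 0 1 (m * L + 1)‖ := by
  set q := recSol (fun k => 2 + (c k : ℂ) * (R * Complex.I)) 0 1 with hq
  have hn2 : ∀ k, 2 ≤ ‖2 + (c k : ℂ) * (R * Complex.I)‖ := by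
    intro k
    refine le_trans ?_ (Complex.abs_re_le_norm _)
    simp
  have hnc : ∀ k, R * |c k| ≤ ‖2 + (c k : ℂ) * (R * Complex.I)‖ := by
    intro k
    refine le_trans ?_ (Complex.abs_im_le_norm _)
    simp [abs_mul, abs_of_pos hR, mul_comm]
  have hstep : ∀ k, ‖2 + (c (k + 1) : ℂ) * (R * Complex.I)‖ * ‖q (k + 1)‖ - ‖q k‖
      ≤ ‖q (k + 2)‖ := by
    intro k
    rw [← norm_mul]
    exact norm_sub_norm_le _ _
  have hmono' : ∀ k, ‖q k‖ ≤ ‖q (k + 1)‖ := by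
    intro k
    induction k with
    | zero => simp [hq, recSol]
    | succ k ih =>
      have := hstep k
      nlinarith [hn2 (k + 1), norm_nonneg (q (k + 1))]
  have hmono : Monotone fun k => ‖q k‖ := monotone_nat_of_le_succ hmono'
  have hgrow : ∀ i, 0 < i → δ ≤ |c i| → δ / 2 * R * ‖q i‖ ≤ ‖q (i + 1)‖ := by
    rintro (_ | i) hi hδ
    · omega
    · have h1 := hstep i
      have h2 := hmono' i
      have h3 : R * δ ≤ ‖2 + (c (i + 1) : ℂ) * (R * Complex.I)‖ :=
        (mul_le_mul_of_nonneg_left hδ hR.le).trans (hnc _)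
      nlinarith [norm_nonneg (q (i + 1))]
  induction m with
  | zero => simp [hq, recSol]
  | succ m ih =>
    obtain ⟨i, h1, h2, h3⟩ := hc (m * L)
    have e1 : ‖q (m * L + 1)‖ ≤ ‖q i‖ := hmono h1
    have e2 : ‖q (i + 1)‖ ≤ ‖q ((m + 1) * L + 1)‖ := hmono (by linarith)
    have e3 := hgrow i (by omega) h3
    have e4 : 0 ≤ δ / 2 * R := by linarith
    calc (δ / 2 * R) ^ (m + 1) = δ / 2 * R * (δ / 2 * R) ^ m := pow_succ' _ _
      _ ≤ δ / 2 * R * ‖q i‖ := by gcongr; exact ih.trans e1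
      _ ≤ _ := e3.trans e2

theorem card_le_sum_of_one_le_prod {ι : Type*} (s : Finset ι) (z : ι → ℝ) (hz : ∀ i ∈ s, 0 ≤ z i)
    (h : 1 ≤ ∏ i ∈ s, z i) : (s.card : ℝ) ≤ ∑ i ∈ s, z i := by
  have h1 : ∏ i ∈ s, z i ≤ ∏ i ∈ s, Real.exp (z i - 1) :=
    Finset.prod_le_prod hz fun i _ => by linarith [Real.add_one_le_exp (z i - 1)]
  rw [← Real.exp_sum] at h1
  have h2 := Real.one_le_exp_iff.1 (h.trans h1)
  simp only [Finset.sum_sub_distrib, Finset.sum_const, nsmul_eq_mul, mul_one] at h2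
  linarith

theorem lintegral_inv_sqrt_lt_top :
    ∫⁻ x in Ioo (-1 : ℝ) 1, ENNReal.ofReal (|x| ^ (-(1 / 2) : ℝ)) < ⊤ := by
  have h1 : IntegrableOn (fun x : ℝ => |x| ^ (-(1 / 2) : ℝ)) (Ioo 0 1) := by
    have := (intervalIntegral.intervalIntegrable_rpow' (a := 0) (b := 1)
      (r := -(1 / 2)) (by norm_num))
    rw [intervalIntegrable_iff_integrableOn_Ioo_of_le zero_le_one] at this
    refine this.congr_fun (fun x hx => ?_) measurableSet_Ioo
    simp only [abs_of_pos hx.1]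
  have h2 : IntegrableOn (fun x : ℝ => |x| ^ (-(1 / 2) : ℝ)) (Ioo (-1) 0) := by
    have := h1.comp_neg
    simpa using this
  have h3 : IntegrableOn (fun x : ℝ => |x| ^ (-(1 / 2) : ℝ)) (Ioo (-1) 1) := by
    refine ((h2.union h1).union (integrableOn_singleton (x := (0 : ℝ)) (hx := by simp))).mono_set ?_
    intro x hx
    rcases lt_trichotomy x 0 with h | h | h
    · exact Or.inl (Or.inl ⟨hx.1, h⟩)
    · exact Or.inr h
    · exact Or.inl (Or.inr ⟨h, hx.2⟩)
  exact h3.lintegral_lt_top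

theorem lintegral_inv_sqrt_sub_le (r a b : ℝ) :
    ∫⁻ x in Icc a b, ENNReal.ofReal (|x - r| ^ (-(1 / 2) : ℝ)) ≤
      (∫⁻ x in Ioo (-1 : ℝ) 1, ENNReal.ofReal (|x| ^ (-(1 / 2) : ℝ))) + ENNReal.ofReal (b - a) := by
  set w : ℝ → ENNReal := fun x => ENNReal.ofReal (|x| ^ (-(1 / 2) : ℝ)) with hw
  have hwm : Measurable w := by fun_prop
  have h1 : ∀ x, w (x - r) ≤ (Ioo (-1 : ℝ) 1).indicator w (x - r) + 1 := by
    intro x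
    by_cases hx : x - r ∈ Ioo (-1 : ℝ) 1
    · rw [indicator_of_mem hx]
      exact le_self_add
    · rw [indicator_of_notMem hx, zero_add, hw]
      refine ENNReal.ofReal_le_one.2 (Real.rpow_le_one_of_one_le_of_nonpos ?_ (by norm_num))
      by_contra! h
      exact hx (abs_lt.1 h)
  calc ∫⁻ x in Icc a b, w (x - r)
      ≤ ∫⁻ x in Icc a b, ((Ioo (-1 : ℝ) 1).indicator w (x - r) + 1) := lintegral_mono h1
    _ = (∫⁻ x in Icc a b, (Ioo (-1 : ℝ) 1).indicator w (x - r)) + ENNReal.ofReal (b - a) := by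
        rw [lintegral_add_right _ measurable_const]
        simp
    _ ≤ (∫⁻ x, (Ioo (-1 : ℝ) 1).indicator w (x - r)) + ENNReal.ofReal (b - a) := by
        gcongr
        exact Measure.restrict_le_self
    _ = _ := by
        rw [lintegral_sub_right_eq_self (fun x => (Ioo (-1 : ℝ) 1).indicator w x) r,
          lintegral_indicator measurableSet_Ioo]

/-- A Cartan-type estimate: sublevel sets of products of distances are small. -/
theorem exists_volume_prod_abs_sub_le : ∃ K : ℝ, 0 ≤ K ∧ ∀ {ι : Type} (s : Finset ι) (r : ι → ℝ)
    (a b h : ℝ), s.Nonempty → a ≤ b → 0 < h →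
    volume {x | x ∈ Icc a b ∧ ∏ i ∈ s, |x - r i| ≤ (h ^ 2) ^ s.card} ≤
      ENNReal.ofReal (h * (K + (b - a))) := by
  set K := ∫⁻ x in Ioo (-1 : ℝ) 1, ENNReal.ofReal (|x| ^ (-(1 / 2) : ℝ)) with hK
  have hKt : K ≠ ⊤ := lintegral_inv_sqrt_lt_top.ne
  refine ⟨K.toReal, ENNReal.toReal_nonneg, fun {ι} s r a b h hs hab hh => ?_⟩
  set F : ℝ → ENNReal :=
    fun x => ∑ i ∈ s, ENNReal.ofReal h * ENNReal.ofReal (|x - r i| ^ (-(1 / 2) : ℝ)) with hF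
  have hFm : Measurable F := by fun_prop
  have hsub : {x | x ∈ Icc a b ∧ ∏ i ∈ s, |x - r i| ≤ (h ^ 2) ^ s.card} ⊆
      ({x | (s.card : ENNReal) ≤ F x} ∩ Icc a b) ∪ r '' s := by
    rintro x ⟨hx, hp⟩
    by_cases hr : x ∈ r '' s
    · exact Or.inr hr
    refine Or.inl ⟨?_, hx⟩
    have hpos : ∀ i ∈ s, 0 < |x - r i| := fun i hi =>
      abs_pos.2 (sub_ne_zero.2 fun h => hr ⟨i, hi, h.symm⟩)
    have key := card_le_sum_of_one_le_prod s (fun i => h * |x - r i| ^ (-(1 / 2) : ℝ))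
      (fun i _ => by positivity) ?_
    · have : F x = ENNReal.ofReal (∑ i ∈ s, h * |x - r i| ^ (-(1 / 2) : ℝ)) := by
        rw [ENNReal.ofReal_sum_of_nonneg (fun i _ => by positivity)]
        exact Finset.sum_congr rfl fun i _ => (ENNReal.ofReal_mul hh.le).symm
      simp only [mem_ofPred_eq, this]
      rw [← ENNReal.ofReal_natCast]
      exact ENNReal.ofReal_le_ofReal key
    · rw [Finset.prod_mul_distrib, Finset.prod_const,
        Real.finsetProd_rpow _ _ (fun i hi => (hpos i hi).le)]
      have hp0 : 0 < ∏ i ∈ s, |x - r i| := Finset.prod_pos hpos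
      have h1 := Real.rpow_le_rpow_of_nonpos hp0 hp (by norm_num : (-(1 / 2) : ℝ) ≤ 0)
      have h2 : ((h ^ 2) ^ s.card) ^ (-(1 / 2) : ℝ) = (h ^ s.card)⁻¹ := by
        rw [← pow_mul, mul_comm, pow_mul, Real.rpow_neg (by positivity), ← Real.sqrt_eq_rpow,
          Real.sqrt_sq (by positivity)]
      rw [h2] at h1
      calc (1 : ℝ) = h ^ s.card * (h ^ s.card)⁻¹ := (mul_inv_cancel₀ (by positivity)).symm
        _ ≤ _ := by gcongr
  have hcard : (s.card : ENNReal) ≠ 0 := by exact_mod_cast hs.card_pos.ne'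
  have hmain : volume ({x | (s.card : ENNReal) ≤ F x} ∩ Icc a b) ≤
      ENNReal.ofReal (h * (K.toReal + (b - a))) := by
    have hM := mul_meas_ge_le_lintegral (μ := volume.restrict (Icc a b)) hFm s.card
    rw [Measure.restrict_apply (measurableSet_le measurable_const hFm)] at hM
    have hI : ∫⁻ x in Icc a b, F x ≤ s.card * ENNReal.ofReal (h * (K.toReal + (b - a))) := by
      rw [hF, lintegral_finsetSum _ (fun i _ => by fun_prop), ← nsmul_eq_mul]
      refine Finset.sum_le_card_nsmul _ _ _ fun i _ => ?_
      rw [lintegral_const_mul _ (by fun_prop), ENNReal.ofReal_mul hh.le,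
        ENNReal.ofReal_add ENNReal.toReal_nonneg (by linarith), ENNReal.ofReal_toReal hKt]
      gcongr
      exact lintegral_inv_sqrt_sub_le _ _ _
    exact (ENNReal.mul_le_mul_iff_right hcard (ENNReal.natCast_ne_top _)).1 (hM.trans hI)
  calc _ ≤ volume (({x | (s.card : ENNReal) ≤ F x} ∩ Icc a b) ∪ r '' s) := measure_mono hsub
    _ ≤ _ + volume (r '' s) := measure_union_le _ _
    _ ≤ _ := by
      rw [(s.finite_toSet.image r).measure_zero, add_zero]
      exact hmain

theorem exists_eval_eq_mul_prod (p : ℂ[X]) : ∃ d ≤ p.natDegree, ∃ s : Fin d → ℂ,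
    ∀ z, p.eval z = p.leadingCoeff * ∏ i, (z - s i) := by
  refine ⟨p.roots.toList.length, by simpa using p.card_roots', fun i => p.roots.toList[i.1],
    fun z => ?_⟩
  rw [Fin.prod_univ_fun_getElem p.roots.toList (fun r => z - r),
    (IsAlgClosed.splits p).eval_eq_prod_roots,
    ← Multiset.prod_coe, ← Multiset.map_coe, Multiset.coe_toList]

/-- The points whose modulus is comparable to `R`. -/
def Comparable (R : ℝ) (s : ℂ) : Prop := R / 4 < ‖s‖ ∧ ‖s‖ < 4 * R

open Classical in
theorem norm_sub_mul_ite_le {R x : ℝ} (hR : 0 < R) (hx : x ∈ Icc R (2 * R)) (s : ℂ) :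
    ‖(R * Complex.I : ℂ) - s‖ * (if Comparable R s then |x - s.re| else 1) ≤
      ‖(x : ℂ) - s‖ * ((if Comparable R s then 5 * R else 1) * 4) := by
  have hI : ‖(R * Complex.I : ℂ)‖ = R := by simp [abs_of_pos hR]
  have h1 := norm_sub_le (R * Complex.I : ℂ) s
  rw [hI] at h1
  have hxn : ‖(x : ℂ)‖ = x := by
    rw [Complex.norm_real, Real.norm_of_nonneg (hR.le.trans hx.1)]
  split_ifs with hs
  · have h2 : |x - s.re| ≤ ‖(x : ℂ) - s‖ := by
      simpa using Complex.abs_re_le_norm ((x : ℂ) - s)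
    have h3 : ‖(R * Complex.I : ℂ) - s‖ ≤ 5 * R := by linarith [hs.2]
    calc _ ≤ (5 * R) * ‖(x : ℂ) - s‖ := by gcongr
      _ ≤ _ := by nlinarith [mul_nonneg hR.le (norm_nonneg ((x : ℂ) - s))]
  · have h2 := norm_sub_norm_le (x : ℂ) s
    have h3 := norm_sub_norm_le s (x : ℂ)
    rw [norm_sub_rev] at h3
    rw [hxn] at h2 h3
    rw [Comparable, not_and_or, not_lt, not_lt] at hs
    obtain ⟨h4, h5⟩ := hx
    rcases hs with hs | hs <;> linarith

open Classical in
theorem norm_prod_sub_mul_le {R x : ℝ} (hR : 0 < R) (hx : x ∈ Icc R (2 * R)) {d : ℕ}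
    (s : Fin d → ℂ) :
    ‖∏ i, ((R * Complex.I : ℂ) - s i)‖ *
        ∏ i ∈ Finset.univ.filter (fun i => Comparable R (s i)), |x - (s i).re| ≤
      ‖∏ i, ((x : ℂ) - s i)‖ *
        ((5 * R) ^ (Finset.univ.filter (fun i => Comparable R (s i))).card * 4 ^ d) := by
  have h := Finset.prod_le_prod (s := Finset.univ)
    (fun i _ => by split_ifs <;> positivity) (fun i _ => norm_sub_mul_ite_le hR hx (s i))
  rw [Finset.prod_mul_distrib, Finset.prod_mul_distrib, Finset.prod_mul_distrib,
    ← Finset.prod_filter, ← Finset.prod_filter, Finset.prod_const, Finset.prod_const,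
    Finset.card_univ, Fintype.card_fin, ← norm_prod, ← norm_prod] at h
  exact h

open Classical in
theorem card_comparable_two_pow_le (B : Finset ℕ) (s : ℂ) :
    (B.filter fun j => Comparable (2 ^ j) s).card ≤ 4 := by
  by_cases hne : (B.filter fun j => Comparable (2 ^ j) s).Nonempty
  · set a := (B.filter fun j => Comparable (2 ^ j) s).min' hne
    have ha := (Finset.mem_filter.1 (Finset.min'_mem _ hne)).2
    have hsub : (B.filter fun j => Comparable (2 ^ j) s) ⊆ Finset.Ico a (a + 4) := by
      intro j hj
      refine Finset.mem_Ico.2 ⟨Finset.min'_le _ _ hj, ?_⟩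
      have h1 := (Finset.mem_filter.1 hj).2.1
      have h2 := ha.2
      have h3 : (2 : ℝ) ^ j < 2 ^ (a + 4) := by
        rw [pow_add]
        norm_num
        linarith
      exact (pow_lt_pow_iff_right₀ (by norm_num)).1 h3
    simpa using Finset.card_le_card hsub
  · rw [Finset.not_nonempty_iff_eq_empty.1 hne]
    simp

open Classical in
theorem sum_card_comparable_two_pow_le (B : Finset ℕ) {d : ℕ} (s : Fin d → ℂ) :
    ∑ j ∈ B, (Finset.univ.filter fun i => Comparable (2 ^ j) (s i)).card ≤ d * 4 := by
  simp_rw [Finset.card_filter]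
  rw [Finset.sum_comm]
  simp_rw [← Finset.card_filter]
  refine (Finset.sum_le_card_nsmul _ _ 4 fun i _ => card_comparable_two_pow_le B (s i)).trans ?_
  simp

open Classical in
/-- Only finitely many dyadic scales carry a positive proportion of the zeros. -/
theorem finite_bad_scales (U : Ultrafilter ℕ) (L : ℕ) {d : ℕ → ℕ}
    (hd : ∀ m, d m ≤ m * L) (s : ∀ m, Fin (d m) → ℂ) :
    {j : ℕ | ¬ ∀ᶠ m in U,
      12 * (Finset.univ.filter fun i => Comparable (2 ^ j) (s m i)).card ≤ m}.Finite := by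
  by_contra hinf
  obtain ⟨B, hB, hcard⟩ := Set.Infinite.exists_subset_card_eq hinf (48 * L + 1)
  have hall : ∀ᶠ m in U, ∀ j ∈ B,
      m < 12 * (Finset.univ.filter fun i => Comparable (2 ^ j) (s m i)).card := by
    rw [Finset.eventually_all]
    intro j hj
    have := Ultrafilter.eventually_not.2 (hB hj)
    simpa using this
  obtain ⟨m, hm⟩ := hall.exists
  have h1 := Finset.card_nsmul_le_sum B _ (m + 1) fun j hj => Nat.succ_le_of_lt (hm j hj)
  rw [← Finset.mul_sum, hcard, smul_eq_mul] at h1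
  have h2 := sum_card_comparable_two_pow_le B (s m)
  have h3 := hd m
  nlinarith

/-- A sequence of polynomials of degree `O(m)` that grows geometrically along the imaginary axis
is bounded only on a set of positive reals of finite measure. -/
theorem volume_bounded_lt_top (P : ℕ → ℂ[X]) (L : ℕ) (hdeg : ∀ m, (P m).natDegree ≤ m * L)
    {a R₀ : ℝ} (ha : 0 < a)
    (hP : ∀ m, ∀ R ≥ R₀, (a * R) ^ m ≤ ‖(P m).eval (R * Complex.I : ℂ)‖) :
    volume {x : ℝ | 0 < x ∧ ∃ C : ℝ, ∀ m, ‖(P m).eval (x : ℂ)‖ ≤ C} < ⊤ := by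
  classical
  obtain ⟨K, hK0, hK⟩ := exists_volume_prod_abs_sub_le
  choose d hd s hs using fun m => exists_eval_eq_mul_prod (P m)
  set k : ℕ → ℕ → ℕ :=
    fun j m => (Finset.univ.filter fun i => Comparable (2 ^ j) (s m i)).card with hk
  set U : Ultrafilter ℕ := hyperfilter ℕ
  have hU : (U : Filter ℕ) ≤ atTop := Nat.hyperfilter_le_atTop
  obtain ⟨N₁, hN₁⟩ := (finite_bad_scales U L (fun m => (hd m).trans (hdeg m)) s).bddAbove
  obtain ⟨N₂, hN₂⟩ := pow_unbounded_of_one_lt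
    (max (max R₀ 5) (4 * (4 ^ L / a) ^ 2)) (one_lt_two : (1 : ℝ) < 2)
  set N := max (N₁ + 1) N₂
  set E : ℕ → Set ℝ := fun C => {x : ℝ | ∀ m, ‖(P m).eval (x : ℂ)‖ ≤ C} with hE
  have hEmono : Monotone E := fun C C' hCC x hx m =>
    (hx m).trans (by exact_mod_cast hCC)
  have hscale : ∀ j ≥ N, ∀ C, volume (E C ∩ Icc (2 ^ j) (2 * 2 ^ j)) ≤
      ENNReal.ofReal ((K + 1) * (1 / 2) ^ j) := by
    intro j hj C
    have hgood : ∀ᶠ m in U, 12 * k j m ≤ m := by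
      by_contra h
      have : j ≤ N₁ := hN₁ h
      have : N₁ + 1 ≤ N := le_max_left _ _
      omega
    have hR : max (max R₀ 5) (4 * (4 ^ L / a) ^ 2) < (2 : ℝ) ^ j :=
      hN₂.trans_le (pow_le_pow_right₀ one_le_two ((le_max_right _ _).trans hj))
    have h2j : ((1 / 2 : ℝ)) ^ j = ((2 : ℝ) ^ j)⁻¹ := by
      rw [one_div, inv_pow]
    rw [h2j]
    obtain ⟨m, hm, hCm⟩ := (hgood.and ((eventually_ge_atTop C).filter_mono hU)).exists
    simp only [hk] at hm
    generalize (2 : ℝ) ^ j = R at *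
    simp only [max_lt_iff] at hR
    obtain ⟨⟨hR₀, hR5⟩, hRa⟩ := hR
    have hR0 : 0 < R := by linarith
    set S := Finset.univ.filter fun i => Comparable R (s m i) with hS
    have hlow := hP m R hR₀.le
    have hC2 : (C : ℝ) < 2 ^ m := by
      exact_mod_cast hCm.trans_lt Nat.lt_two_pow_self
    have hbase : 4 * R * (4 ^ L) ^ 2 ≤ (a * R) ^ 2 := by
      rw [div_pow, mul_div_assoc', div_lt_iff₀ (by positivity)] at hRa
      nlinarith
    have hpow : (C : ℝ) * R ^ (6 * S.card) * 4 ^ d m < (a * R) ^ m := by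
      refine (pow_lt_pow_iff_left₀ (by positivity) (by positivity) two_ne_zero).1 ?_
      have hRk : R ^ (12 * S.card) ≤ R ^ m := pow_le_pow_right₀ (by linarith) hm
      have h4d : (4 : ℝ) ^ d m ≤ 4 ^ (m * L) :=
        pow_le_pow_right₀ (by norm_num) ((hd m).trans (hdeg m))
      calc ((C : ℝ) * R ^ (6 * S.card) * 4 ^ d m) ^ 2
          = (C : ℝ) ^ 2 * R ^ (12 * S.card) * (4 ^ d m) ^ 2 := by ring
        _ < (2 ^ m) ^ 2 * R ^ (12 * S.card) * (4 ^ d m) ^ 2 := by gcongr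
        _ ≤ (2 ^ m) ^ 2 * R ^ m * (4 ^ (m * L)) ^ 2 := by gcongr
        _ = (4 * R * (4 ^ L) ^ 2) ^ m := by
          rw [mul_pow, mul_pow, pow_mul', pow_right_comm 2 m 2, pow_right_comm _ m 2]
          norm_num
        _ ≤ ((a * R) ^ 2) ^ m := by gcongr
        _ = ((a * R) ^ m) ^ 2 := by ring
    have hsmall : ∀ x ∈ E C ∩ Icc R (2 * R),
        ∏ i ∈ S, |x - (s m i).re| < (((R ^ 2)⁻¹) ^ 2) ^ S.card := by
      rintro x ⟨hxE, hxR⟩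
      have h1 := mul_le_mul_of_nonneg_left (norm_prod_sub_mul_le hR0 hxR (s m))
        (norm_nonneg (P m).leadingCoeff)
      rw [← mul_assoc, ← mul_assoc, ← norm_mul, ← norm_mul, ← hs, ← hs, ← hS] at h1
      have hx := hxE m
      set Q := ∏ i ∈ S, |x - (s m i).re|
      have hQ : 0 ≤ Q := Finset.prod_nonneg fun i _ => abs_nonneg _
      have hR5k : (5 * R) ^ S.card ≤ (R ^ 2) ^ S.card := by
        gcongr
        nlinarith
      have h2 : (a * R) ^ m * (Q * R ^ (6 * S.card)) < (a * R) ^ m * (R ^ 2) ^ S.card :=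
        calc (a * R) ^ m * (Q * R ^ (6 * S.card))
            = (a * R) ^ m * Q * R ^ (6 * S.card) := by ring
          _ ≤ C * ((5 * R) ^ S.card * 4 ^ d m) * R ^ (6 * S.card) := by
            refine mul_le_mul_of_nonneg_right ?_ (by positivity)
            calc (a * R) ^ m * Q ≤ ‖(P m).eval (R * Complex.I : ℂ)‖ * Q := by gcongr
              _ ≤ _ := h1
              _ ≤ _ := by gcongr
          _ = (C * R ^ (6 * S.card) * 4 ^ d m) * (5 * R) ^ S.card := by ring
          _ < (a * R) ^ m * (5 * R) ^ S.card := by gcongr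
          _ ≤ _ := by gcongr
      have h3 := lt_of_mul_lt_mul_left h2 (by positivity)
      have h4 : Q * (R ^ 4) ^ S.card * (R ^ 2) ^ S.card < 1 * (R ^ 2) ^ S.card :=
        calc Q * (R ^ 4) ^ S.card * (R ^ 2) ^ S.card = Q * R ^ (6 * S.card) := by ring
          _ < _ := by rwa [one_mul]
      have h5 := lt_of_mul_lt_mul_right h4 (by positivity)
      rw [inv_pow, inv_pow, ← pow_mul R 2 2, ← one_div, lt_div_iff₀ (by positivity)]
      exact h5
    rcases S.eq_empty_or_nonempty with hS0 | hS0
    · have : E C ∩ Icc R (2 * R) = ∅ := by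
        refine eq_empty_of_forall_notMem fun x hx => ?_
        simpa [hS0] using hsmall x hx
      simp [this]
    · refine (measure_mono (fun x hx => by exact ⟨hx.2, (hsmall x hx).le⟩)).trans
        ((hK S (fun i => (s m i).re) R (2 * R) (R ^ 2)⁻¹ hS0 (by linarith)
          (by positivity)).trans (ENNReal.ofReal_le_ofReal ?_))
      rw [inv_mul_eq_div, ← div_eq_mul_inv, div_le_div_iff₀ (by positivity) hR0]
      nlinarith [mul_nonneg hK0 (by nlinarith : 0 ≤ R ^ 2 - R)]
  have hscale' : ∀ j ≥ N, volume ((⋃ C, E C) ∩ Icc (2 ^ j) (2 * 2 ^ j)) ≤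
      ENNReal.ofReal ((K + 1) * (1 / 2) ^ j) := by
    intro j hj
    rw [iUnion_inter, Monotone.measure_iUnion]
    · exact iSup_le fun C => hscale j hj C
    · exact fun C C' h => inter_subset_inter_left _ (hEmono h)
  have hcover : {x : ℝ | 0 < x ∧ ∃ C : ℝ, ∀ m, ‖(P m).eval (x : ℂ)‖ ≤ C} ⊆
      Icc 0 (2 ^ N) ∪ ⋃ j, ((⋃ C, E C) ∩ Icc (2 ^ (N + j)) (2 * 2 ^ (N + j))) := by
    rintro x ⟨hx, C, hC⟩
    rcases le_total x (2 ^ N) with h | h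
    · exact Or.inl ⟨hx.le, h⟩
    · right
      obtain ⟨C', hC'⟩ := exists_nat_ge C
      have hx1 : 1 ≤ x := (one_le_pow₀ one_le_two).trans h
      obtain ⟨n, hn1, hn2⟩ := exists_nat_pow_near hx1 (one_lt_two : (1 : ℝ) < 2)
      have hNn : N < n + 1 := (pow_lt_pow_iff_right₀ one_lt_two).1 (h.trans_lt hn2)
      obtain ⟨j, rfl⟩ := Nat.exists_eq_add_of_le (Nat.lt_succ_iff.1 hNn)
      rw [pow_succ'] at hn2
      exact mem_iUnion.2 ⟨j, mem_iUnion.2 ⟨C', fun m => (hC m).trans hC'⟩, hn1, hn2.le⟩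
  refine (measure_mono hcover).trans_lt ((measure_union_le _ _).trans_lt ?_)
  refine ENNReal.add_lt_top.2 ⟨by simp, (measure_iUnion_le _).trans_lt ?_⟩
  refine (ENNReal.tsum_le_tsum fun j => hscale' (N + j) (Nat.le_add_right _ _)).trans_lt ?_
  rw [← ENNReal.ofReal_tsum_of_nonneg (fun j => by positivity)]
  · exact ENNReal.ofReal_lt_top
  · simp_rw [pow_add]
    exact (summable_geometric_two.mul_left _).mul_left _


/-- For every real sequence `{c_k}`, the set of parameters `t ∈ (0,∞)` for which every
solution of the difference equation `q_{k+1} − (2 + t c_k) q_k + q_{k−1} = 0` (k ≥ 1)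
is bounded, has finite Lebesgue measure. -/
theorem finite_measure_of_bounded_solutions (c : ℕ → ℝ) :
    MeasureTheory.volume
      {t : ℝ | 0 < t ∧ ∀ q : ℕ → ℝ,
        (∀ k : ℕ, 1 ≤ k → q (k + 1) - (2 + t * c k) * q k + q (k - 1) = 0) →
        ∃ C : ℝ, ∀ k : ℕ, |q k| ≤ C} < ⊤ := by
  set T : Set ℝ := {t : ℝ | 0 < t ∧ ∀ q : ℕ → ℝ,
    (∀ k : ℕ, 1 ≤ k → q (k + 1) - (2 + t * c k) * q k + q (k - 1) = 0) →
    ∃ C : ℝ, ∀ k : ℕ, |q k| ≤ C} with hT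
  have hsol : ∀ t ∈ T, ∀ a b : ℝ, ∃ C : ℝ, ∀ k, |recSol (fun k => 2 + t * c k) a b k| ≤ C := by
    intro t ht a b
    refine ht.2 _ fun k hk => ?_
    obtain ⟨n, rfl⟩ := Nat.exists_eq_add_of_le' hk
    simp only [recSol, Nat.add_sub_cancel]
    ring
  rcases T.eq_empty_or_nonempty with h0 | ⟨t, ht⟩
  · simp [h0]
  obtain ⟨M₁, hM₁⟩ := hsol t ht 0 1
  obtain ⟨M₂, hM₂⟩ := hsol t ht 1 0
  obtain ⟨δ, hδ, L, hL⟩ := exists_window (M := max M₁ M₂) ht.1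
    (fun n => (hM₁ n).trans (le_max_left _ _)) (fun n => (hM₂ n).trans (le_max_right _ _))
  have heval : ∀ (z : ℂ) n, (recSol (fun k => 2 + C (c k : ℂ) * X) 0 1 n).eval z =
      recSol (fun k => 2 + (c k : ℂ) * z) 0 1 n := by
    intro z n
    have := map_recSol (evalRingHom z) (fun k => 2 + C (c k : ℂ) * X) 0 1 n
    simpa using this
  have hreal : ∀ (x : ℝ) n, recSol (fun k => 2 + (c k : ℂ) * x) 0 1 n =
      (recSol (fun k => 2 + x * c k) 0 1 n : ℝ) := by
    intro x n
    have := map_recSol Complex.ofRealHom (fun k => 2 + x * c k) 0 1 n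
    simpa [mul_comm] using this.symm
  refine (measure_mono ?_).trans_lt (volume_bounded_lt_top
    (fun m => recSol (fun k => 2 + C (c k : ℂ) * X) 0 1 (m * L + 1)) L
    (fun m => natDegree_recSol_le _ _) (a := δ / 2) (R₀ := 2 / δ) (by positivity) ?_)
  · intro x hx
    obtain ⟨M, hM⟩ := hsol x hx 0 1
    refine ⟨hx.1, M, fun m => ?_⟩
    rw [heval, hreal, Complex.norm_real]
    exact hM _
  · intro m R hR
    rw [heval]
    exact norm_recSol_growth hL ((by positivity : 0 < 2 / δ).trans_le hR)
      ((div_le_iff₀ hδ).1 hR) m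
end

section
/- Let E ⊆ [1, +∞) be a measurable set such that |E ∩ [a, 4a]| ≤ 1 for every a > 0. Then for every a > 0, ∫_{E ∩ [a, ∞)} dt/t ≤ 4/(3a) · a = 4/3 · (1/a) · a, i.e. ∫_{E ∩ [a, ∞)} (1/t) dt ≤ 4/(3a). -/
open MeasureTheory

/-- The half-line `[a, ∞)` is covered by the intervals `[cⁿ a, cⁿ⁺¹ a]`. -/
lemma Ici_subset_iUnion_Icc_pow_mul {a c : ℝ} (ha : 0 < a) (hc : 1 < c) :
    Set.Ici a ⊆ ⋃ n : ℕ, Set.Icc (c ^ n * a) (c * (c ^ n * a)) := by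
  intro t ht
  obtain ⟨n, hn₁, hn₂⟩ := exists_nat_pow_near ((one_le_div ha).2 ht) hc
  rw [le_div_iff₀ ha] at hn₁
  rw [div_lt_iff₀ ha, pow_succ'] at hn₂
  exact Set.mem_iUnion.2 ⟨n, hn₁, by linarith⟩

/-- On a set of measure at most `1` bounded below by `b > 0`, the integral of `1 / t` is at most
`1 / b`. -/
lemma lintegral_one_div_le_of_subset_Ici {s : Set ℝ} {b : ℝ} (hs : MeasurableSet s) (hb : 0 < b)
    (hsb : s ⊆ Set.Ici b) (hvol : volume s ≤ 1) :
    ∫⁻ t in s, ENNReal.ofReal (1 / t) ≤ ENNReal.ofReal (1 / b) :=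
  calc ∫⁻ t in s, ENNReal.ofReal (1 / t)
      ≤ ∫⁻ _ in s, ENNReal.ofReal (1 / b) :=
        setLIntegral_mono' hs fun _ ht ↦
          ENNReal.ofReal_le_ofReal (one_div_le_one_div_of_le hb (hsb ht))
    _ = ENNReal.ofReal (1 / b) * volume s := setLIntegral_const _ _
    _ ≤ ENNReal.ofReal (1 / b) := mul_le_of_le_one_right' hvol

/-- If `E ⊆ [1, ∞)` satisfies `|E ∩ [a, 4a]| ≤ 1` for every `a > 0`, then
`∫_{E ∩ [a, ∞)} dt/t ≤ 4/(3a)` for every `a > 0`. -/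
theorem integral_inv_le_of_thin_set
    (E : Set ℝ) (hEm : MeasurableSet E) (hE1 : E ⊆ Set.Ici 1)
    (hcap : ∀ a : ℝ, 0 < a → volume (E ∩ Set.Icc a (4 * a)) ≤ 1) :
    ∀ a : ℝ, 0 < a →
      ∫⁻ t in E ∩ Set.Ici a, ENNReal.ofReal (1 / t) ≤ ENNReal.ofReal (4 / (3 * a)) := by
  intro a ha
  have h_sum : HasSum (fun n : ℕ ↦ 1 / ((4 : ℝ) ^ n * a)) (4 / (3 * a)) := by
    have h_geom := (hasSum_geometric_of_lt_one (r := (1 / 4 : ℝ)) (by norm_num)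
      (by norm_num)).mul_right (1 / a)
    have h_value : (1 - 1 / 4 : ℝ)⁻¹ * (1 / a) = 4 / (3 * a) := by
      field_simp
      norm_num
    simpa only [one_div_pow, one_div_mul_one_div, h_value] using h_geom
  calc ∫⁻ t in E ∩ Set.Ici a, ENNReal.ofReal (1 / t)
      ≤ ∫⁻ t in ⋃ n : ℕ, E ∩ Set.Icc (4 ^ n * a) (4 * (4 ^ n * a)), ENNReal.ofReal (1 / t) := by
        refine lintegral_mono_set ?_
        rw [← Set.inter_iUnion]
        exact Set.inter_subset_inter_right E (Ici_subset_iUnion_Icc_pow_mul ha (by norm_num))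
    _ ≤ ∑' n : ℕ, ∫⁻ t in E ∩ Set.Icc (4 ^ n * a) (4 * (4 ^ n * a)), ENNReal.ofReal (1 / t) :=
        lintegral_iUnion_le _ _
    _ ≤ ∑' n : ℕ, ENNReal.ofReal (1 / (4 ^ n * a)) := ENNReal.tsum_le_tsum fun n ↦
        lintegral_one_div_le_of_subset_Ici (hEm.inter measurableSet_Icc) (by positivity)
          (fun _ ht ↦ ht.2.1) (hcap _ (by positivity))
    _ = ENNReal.ofReal (4 / (3 * a)) := by
        rw [← ENNReal.ofReal_tsum_of_nonneg (fun n ↦ by positivity) h_sum.summable, h_sum.tsum_eq]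
end

section
/- Let {c_j}_{j≥0} be real numbers, let M(c) have rows (1,0) and (c,1), and H(t) have rows (1,t) and (0,1). Define Φ_k = M(c_{j(k)}) for k ≥ 1, where j(k) is the largest integer j such that 2^j divides k, and define matrix functions A_{−1}(t) = H(t) and A_{n+1}(t) = A_n(t) M(c_{n+1}) A_n(t) for n ≥ −1. Then for every m ≥ 1 and every t, Φ_{2^m} H(t) Φ_{2^m−1} H(t) ⋯ Φ_1 H(t) = M(c_m) · A_{m−1}(t). -/
/-- `Hmat t` is the horocycle matrix with rows `(1, t)` and `(0, 1)`. -/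
noncomputable def Hmat (t : ℝ) : Matrix (Fin 2) (Fin 2) ℝ := !![1, t; 0, 1]

/-- `Mmat c` is the lower-triangular kick matrix with rows `(1, 0)` and `(c, 1)`. -/
noncomputable def Mmat (c : ℝ) : Matrix (Fin 2) (Fin 2) ℝ := !![1, 0; c, 1]

/-- `kickedProd Φ t n = Φ_n H(t) ⋯ Φ_1 H(t)` (with `kickedProd Φ t 0 = 1`). -/
noncomputable def kickedProd (Φ : ℕ → Matrix (Fin 2) (Fin 2) ℝ) (t : ℝ) :
    ℕ → Matrix (Fin 2) (Fin 2) ℝ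
  | 0 => 1
  | n + 1 => Φ (n + 1) * Hmat t * kickedProd Φ t n

/-- `Amat c t (n + 1)` is the matrix function `A_n(t)` of the paper, where
`A_{−1}(t) = H(t) = Amat c t 0` and `A_{n+1}(t) = A_n(t) M(c_{n+1}) A_n(t)`. -/
noncomputable def Amat (c : ℕ → ℝ) (t : ℝ) : ℕ → Matrix (Fin 2) (Fin 2) ℝ
  | 0 => Hmat t
  | n + 1 => Amat c t n * Mmat (c n) * Amat c t n

/-- The product of the first `a + b` factors splits into the product of the last `b` factors
times the product of the first `a` factors. -/
theorem kickedProd_add (Φ : ℕ → Matrix (Fin 2) (Fin 2) ℝ) (t : ℝ) (a b : ℕ) :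
    kickedProd Φ t (a + b) = kickedProd (fun k => Φ (a + k)) t b * kickedProd Φ t a := by
  induction b with
  | zero => simp [kickedProd]
  | succ b ih =>
    rw [← add_assoc, kickedProd, ih, kickedProd, Matrix.mul_assoc _ _ (kickedProd Φ t a), add_assoc]

/-- `kickedProd Φ t n` depends only on `Φ 1, …, Φ n`. -/
theorem kickedProd_congr {Φ Ψ : ℕ → Matrix (Fin 2) (Fin 2) ℝ} (t : ℝ) (n : ℕ)
    (h : ∀ k, 0 < k → k ≤ n → Φ k = Ψ k) : kickedProd Φ t n = kickedProd Ψ t n := by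
  induction n with
  | zero => rfl
  | succ n ih =>
    rw [kickedProd, kickedProd, h (n + 1) n.succ_pos le_rfl,
      ih fun k hk hkn => h k hk (hkn.trans n.le_succ)]

theorem padicValNat_pow_add {p m k : ℕ} [hp : Fact p.Prime] (hk : 0 < k) (hkm : k < p ^ m) :
    padicValNat p (p ^ m + k) = padicValNat p k := by
  have hlt : padicValNat p k < m := by
    by_contra! hle
    exact (Nat.le_of_dvd hk ((padicValNat_dvd_iff_le hk.ne').2 hle)).not_gt hkm
  have key : ∀ j ≤ m, (j ≤ padicValNat p (p ^ m + k) ↔ j ≤ padicValNat p k) := fun j hj => by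
    rw [← padicValNat_dvd_iff_le (by lia), ← padicValNat_dvd_iff_le hk.ne',
      Nat.dvd_add_right (pow_dvd_pow p hj)]
  refine le_antisymm ?_ ((key _ hlt.le).2 le_rfl)
  by_contra! h
  exact absurd ((key _ hlt).1 h) (Nat.lt_irrefl _)

/-- Peeling the last kick off the abacaba product of length `2 ^ m`. -/
theorem kickedProd_two_pow (c : ℕ → ℝ) (t : ℝ) (m : ℕ) :
    kickedProd (fun k => Mmat (c (padicValNat 2 k))) t (2 ^ m) =
      Mmat (c m) *
        (Hmat t * kickedProd (fun k => Mmat (c (padicValNat 2 k))) t (2 ^ m - 1)) := by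
  have hpos : 0 < 2 ^ m := by positivity
  conv_lhs => rw [← Nat.sub_add_cancel hpos, kickedProd]
  rw [Nat.sub_add_cancel hpos, padicValNat.prime_pow, Matrix.mul_assoc]

/-- The matrix `A_{m-1}(t)` is the abacaba product with `2 ^ m - 1` kicks, preceded and followed
by horocycle matrices. -/
theorem Hmat_mul_kickedProd_eq_Amat (c : ℕ → ℝ) (t : ℝ) (m : ℕ) :
    Hmat t * kickedProd (fun k => Mmat (c (padicValNat 2 k))) t (2 ^ m - 1) = Amat c t m := by
  induction m with
  | zero => simp [kickedProd, Amat]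
  | succ m ih =>
    have hpos : 0 < 2 ^ m := by positivity
    have hsplit : 2 ^ (m + 1) - 1 = 2 ^ m + (2 ^ m - 1) := by lia
    have hshift : kickedProd (fun k => Mmat (c (padicValNat 2 (2 ^ m + k)))) t (2 ^ m - 1) =
        kickedProd (fun k => Mmat (c (padicValNat 2 k))) t (2 ^ m - 1) :=
      kickedProd_congr t _ fun k hk hkm => by rw [padicValNat_pow_add hk (by lia)]
    rw [hsplit, kickedProd_add, hshift, kickedProd_two_pow, ih, ← Matrix.mul_assoc, ih, Amat,
      Matrix.mul_assoc]

/-- For the abacaba kick sequence `Φ_k = M(c_{j(k)})`, where `j(k) = padicValNat 2 k`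
is the largest `j` with `2^j ∣ k`, the dyadic partial products satisfy
`Φ_{2^m} H(t) ⋯ Φ_1 H(t) = M(c_m) A_{m−1}(t)` for all `m ≥ 1`. -/
theorem dyadic_partial_product_eq
    (c : ℕ → ℝ) (t : ℝ) (m : ℕ) (hm : 1 ≤ m) :
    kickedProd (fun k => Mmat (c (padicValNat 2 k))) t (2 ^ m) =
      Mmat (c m) * Amat c t m := by
  rw [kickedProd_two_pow, Hmat_mul_kickedProd_eq_Amat]
end
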